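/- arXiv:1102.1822 — 4 statements merged into one kernel-verified Lean document; each statement's English description precedes it below -/
import Mathlib

section
/- Let H be an n×n real matrix all of whose (complex) eigenvalues h satisfy 0 < Re(h) < 1, let D := H − (1/2)I, let A be an n×n complex matrix, and let t ∈ ℝ. Then the matrix-valued function f(x) := |(e^{itx} − 1)/x|² · ( x_+^{−D} (AA^*) x_+^{−D^*} + x_−^{−D} (\overline{AA^*}) x_−^{−D^*} ) is Bochner integrable on ℝ (equivalently, every entry of f is Lebesgue integrable on ℝ). -/
open MeasureTheory Matrix

/-- `x₊^B := exp((log x) B)` (matrix exponential) for `x > 0`, and the zero matrix otherwise.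
The quantity `x₊^{-D}` of the paper is `matPosPow x (-D)`. -/
noncomputable def matPosPow {n : ℕ} (x : ℝ) (B : Matrix (Fin n) (Fin n) ℂ) :
    Matrix (Fin n) (Fin n) ℂ :=
  if 0 < x then NormedSpace.exp ((Real.log x : ℂ) • B) else 0

/-- The spectral-density-type matrix kernel
`f(x) = |(e^{itx}-1)/x|² (x₊^{-D} (AA^*) x₊^{-D^*} + x₋^{-D} (conj (AA^*)) x₋^{-D^*})`. -/
noncomputable def specKernel {n : ℕ} (D : Matrix (Fin n) (Fin n) ℂ)
    (A : Matrix (Fin n) (Fin n) ℂ) (t : ℝ) (x : ℝ) : Matrix (Fin n) (Fin n) ℂ :=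
  ((‖(Complex.exp (Complex.I * t * x) - 1) / (x : ℂ)‖ ^ 2 : ℝ) : ℂ) •
    (matPosPow x (-D) * (A * Aᴴ) * matPosPow x (-Dᴴ) +
      matPosPow (-x) (-D) * (A * Aᴴ).map (starRingEnd ℂ) * matPosPow (-x) (-Dᴴ))

section ExpGrowth

variable {m : Type*} [Fintype m] [DecidableEq m]

attribute [local instance] Matrix.linftyOpNormedRing Matrix.linftyOpNormedAlgebra

theorem continuous_exp_ofReal_smul (M : Matrix m m ℂ) :
    Continuous fun s : ℝ => NormedSpace.exp ((s : ℂ) • M) := by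
  let _ : NormedAlgebra ℚ (Matrix m m ℂ) := NormedAlgebra.restrictScalars ℚ ℂ _
  exact NormedSpace.exp_continuous.comp (by fun_prop)

theorem exp_smul_one_add (c : ℂ) (N : Matrix m m ℂ) :
    NormedSpace.exp (c • (1 : Matrix m m ℂ) + N) = Complex.exp c • NormedSpace.exp N := by
  rw [Matrix.exp_add_of_commute _ _ ((Commute.one_left N).smul_left c)]
  have h : NormedSpace.exp (c • (1 : Matrix m m ℂ)) = Complex.exp c • 1 := by
    have h := NormedSpace.algebraMap_exp_comm (𝕂 := ℂ) (𝔸 := Matrix m m ℂ) c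
    rw [Algebra.algebraMap_eq_smul_one, Algebra.algebraMap_eq_smul_one] at h
    rw [Complex.exp_eq_exp_ℂ]
    exact h.symm
  rw [h, smul_mul_assoc, one_mul]

/-- The exponential series applied to a vector killed by `N ^ k` is a finite sum. -/
theorem exp_smul_mulVec_eq_sum {N : Matrix m m ℂ} {v : m → ℂ} {k : ℕ} (h : (N ^ k) *ᵥ v = 0)
    (c : ℂ) :
    NormedSpace.exp (c • N) *ᵥ v =
      ∑ l ∈ Finset.range k, ((l.factorial : ℂ)⁻¹ * c ^ l) • ((N ^ l) *ᵥ v) := by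
  have h1 := (NormedSpace.exp_series_hasSum_exp' (𝕂 := ℂ) (c • N)).map
    (AddMonoidHom.mk' (fun A : Matrix m m ℂ => A *ᵥ v) (fun A B => Matrix.add_mulVec A B v))
    (show Continuous fun A : Matrix m m ℂ => A *ᵥ v from
      Continuous.matrix_mulVec continuous_id continuous_const)
  refine h1.unique ?_
  have h2 : ∀ l, ((AddMonoidHom.mk' (fun A : Matrix m m ℂ => A *ᵥ v)
      (fun A B => Matrix.add_mulVec A B v)) ∘ fun l : ℕ => ((l.factorial : ℂ)⁻¹ • (c • N) ^ l)) l
      = ((l.factorial : ℂ)⁻¹ * c ^ l) • ((N ^ l) *ᵥ v) := by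
    intro l
    simp [smul_pow, Matrix.smul_mulVec, smul_smul]
  rw [funext h2]
  refine hasSum_sum_of_ne_finset_zero fun l hl => ?_
  have hl : k ≤ l := by simpa using hl
  obtain ⟨r, rfl⟩ := Nat.exists_eq_add_of_le' hl
  rw [pow_add N, ← Matrix.mulVec_mulVec, h, Matrix.mulVec_zero, smul_zero]

/-- If every eigenvalue of `M` has real part less than `β`, then `s ↦ exp (s M) v` grows at most
like `exp (α s)` for some `α < β`. -/
theorem exists_norm_exp_mulVec_le {M : Matrix m m ℂ} {β : ℝ}
    (hM : ∀ μ ∈ spectrum ℂ M, μ.re < β) (v : m → ℂ) :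
    ∃ α < β, ∃ C, ∀ s : ℝ, 0 ≤ s →
      ‖NormedSpace.exp ((s : ℂ) • M) *ᵥ v‖ ≤ C * Real.exp (α * s) := by
  have hv : v ∈ ⨆ μ, Module.End.maxGenEigenspace (Matrix.toLin' M) μ := by
    rw [Module.End.iSup_maxGenEigenspace_eq_top]; trivial
  induction hv using Submodule.iSup_induction' with
  | zero => exact ⟨β - 1, by linarith, 0, by simp⟩
  | add x y _ _ hx hy =>
    obtain ⟨a, ha, C, hC⟩ := hx
    obtain ⟨b, hb, C', hC'⟩ := hy
    refine ⟨max a b, max_lt ha hb, |C| + |C'|, fun s hs => ?_⟩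
    rw [Matrix.mulVec_add, add_mul]
    refine (norm_add_le _ _).trans (add_le_add ((hC s hs).trans ?_) ((hC' s hs).trans ?_))
    · gcongr
      exacts [le_abs_self _, le_max_left _ _]
    · gcongr
      exacts [le_abs_self _, le_max_right _ _]
  | mem μ x hx =>
    by_cases hx0 : x = 0
    · subst hx0
      exact ⟨β - 1, by linarith, 0, by simp⟩
    obtain ⟨k, hk⟩ := (Module.End.mem_maxGenEigenspace _ _ _).1 hx
    have hμ : μ ∈ spectrum ℂ M := by
      rw [← Matrix.spectrum_toLin', ← Module.End.hasEigenvalue_iff_mem_spectrum]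
      refine Module.End.hasEigenvalue_of_hasGenEigenvalue (k := k) ?_
      intro h
      exact hx0 ((Submodule.mem_bot ℂ).1 (h ▸ (by simpa [Module.End.mem_genEigenspace_nat] using hk)))
    obtain ⟨α, hα, hαβ⟩ := exists_between (hM μ hμ)
    have hδ : 0 < α - μ.re := sub_pos.2 hα
    set N := M - μ • (1 : Matrix m m ℂ) with hN
    have hkN : (N ^ k) *ᵥ x = 0 := by
      have : Matrix.toLin' N = Matrix.toLin' M - μ • 1 := by
        simp [hN, Matrix.toLin'_one]
        rfl
      rwa [← this, ← Matrix.toLin'_pow, Matrix.toLin'_apply] at hk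
    refine ⟨α, hαβ, ∑ l ∈ Finset.range k, ((α - μ.re) ^ l)⁻¹ * ‖(N ^ l) *ᵥ x‖, fun s hs => ?_⟩
    have hsM : (s : ℂ) • M = ((s : ℂ) * μ) • (1 : Matrix m m ℂ) + (s : ℂ) • N := by
      rw [hN, smul_sub, smul_smul]; abel
    rw [hsM, exp_smul_one_add, Matrix.smul_mulVec, exp_smul_mulVec_eq_sum hkN, norm_smul,
      Complex.norm_exp]
    have hre : ((s : ℂ) * μ).re = μ.re * s := by simp [mul_comm]
    rw [hre, show α * s = μ.re * s + (α - μ.re) * s by ring, Real.exp_add, mul_left_comm]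
    refine mul_le_mul_of_nonneg_left ((norm_sum_le _ _).trans ?_) (Real.exp_pos _).le
    rw [Finset.sum_mul]
    refine Finset.sum_le_sum fun l _ => ?_
    rw [norm_smul, norm_mul, norm_inv, norm_pow, Complex.norm_natCast, Complex.norm_real,
      Real.norm_of_nonneg hs, mul_right_comm _ _ (Real.exp _)]
    refine mul_le_mul_of_nonneg_right ?_ (norm_nonneg ((N ^ l) *ᵥ x))
    rw [← div_eq_inv_mul, ← div_eq_inv_mul, le_div_iff₀ (by positivity)]
    calc s ^ l / (l.factorial : ℝ) * (α - μ.re) ^ l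
        = ((α - μ.re) * s) ^ l / (l.factorial : ℝ) := by rw [mul_pow]; ring
      _ ≤ _ := Real.pow_div_factorial_le_exp _ (by positivity) l

theorem exists_norm_exp_apply_le {M : Matrix m m ℂ} {β : ℝ}
    (hM : ∀ μ ∈ spectrum ℂ M, μ.re < β) (i j : m) :
    ∃ α < β, ∃ C, ∀ s : ℝ, 0 ≤ s →
      ‖NormedSpace.exp ((s : ℂ) • M) i j‖ ≤ C * Real.exp (α * s) := by
  obtain ⟨α, hα, C, hC⟩ := exists_norm_exp_mulVec_le hM (Pi.single j 1)
  refine ⟨α, hα, C, fun s hs => le_trans ?_ (hC s hs)⟩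
  simpa using norm_le_pi_norm (NormedSpace.exp ((s : ℂ) • M) *ᵥ Pi.single j 1) i

end ExpGrowth

section MatPosPow

variable {n : ℕ}

theorem measurable_matPosPow_apply (B : Matrix (Fin n) (Fin n) ℂ) (i j : Fin n) :
    Measurable fun x : ℝ => matPosPow x B i j := by
  have h : (fun x : ℝ => matPosPow x B i j) =
      fun x => if 0 < x then NormedSpace.exp ((Real.log x : ℂ) • B) i j else 0 := by
    ext x
    unfold matPosPow
    split_ifs <;> rfl
  rw [h]
  refine Measurable.ite measurableSet_Ioi ?_ measurable_const
  exact ((continuous_exp_ofReal_smul B).matrix_elem i j).measurable.comp Real.measurable_log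

theorem matPosPow_conjTranspose (x : ℝ) (B : Matrix (Fin n) (Fin n) ℂ) :
    matPosPow x Bᴴ = (matPosPow x B)ᴴ := by
  unfold matPosPow
  split_ifs
  · rw [← Matrix.exp_conjTranspose, Matrix.conjTranspose_smul]
    simp
  · simp

theorem exists_norm_matPosPow_le_of_one_le {B : Matrix (Fin n) (Fin n) ℂ} {β : ℝ}
    (hB : ∀ μ ∈ spectrum ℂ B, μ.re < β) (i j : Fin n) :
    ∃ α < β, ∃ C, ∀ x : ℝ, 1 ≤ x → ‖matPosPow x B i j‖ ≤ C * x ^ α := by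
  obtain ⟨α, hα, C, hC⟩ := exists_norm_exp_apply_le hB i j
  refine ⟨α, hα, C, fun x hx => ?_⟩
  have hx0 : 0 < x := by linarith
  rw [matPosPow, if_pos hx0, Real.rpow_def_of_pos hx0, mul_comm (Real.log x)]
  exact hC _ (Real.log_nonneg hx)

theorem exists_norm_matPosPow_le_of_le_one {B : Matrix (Fin n) (Fin n) ℂ} {β : ℝ}
    (hB : ∀ μ ∈ spectrum ℂ B, β < μ.re) (i j : Fin n) :
    ∃ α, β < α ∧ ∃ C, ∀ x : ℝ, 0 < x → x ≤ 1 → ‖matPosPow x B i j‖ ≤ C * x ^ α := by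
  have hB' : ∀ μ ∈ spectrum ℂ (-B), μ.re < -β := by
    intro μ hμ
    rw [← spectrum.neg_eq, Set.mem_neg] at hμ
    have := hB _ hμ
    rw [Complex.neg_re] at this
    linarith
  obtain ⟨α, hα, C, hC⟩ := exists_norm_exp_apply_le hB' i j
  refine ⟨-α, by linarith, C, fun x hx0 hx => ?_⟩
  rw [matPosPow, if_pos hx0, Real.rpow_def_of_pos hx0]
  have := hC (-Real.log x) (by linarith [Real.log_nonpos hx0.le hx])
  simpa [mul_comm] using this

end MatPosPow

/-- The weight `|(e^{itx} - 1) / x|²`. -/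
noncomputable def fourierIncrementWeight (t x : ℝ) : ℝ :=
  ‖(Complex.exp (Complex.I * t * x) - 1) / (x : ℂ)‖ ^ 2

theorem measurable_fourierIncrementWeight (t : ℝ) : Measurable (fourierIncrementWeight t) := by
  unfold fourierIncrementWeight
  fun_prop

theorem fourierIncrementWeight_nonneg (t x : ℝ) : 0 ≤ fourierIncrementWeight t x :=
  sq_nonneg _

theorem fourierIncrementWeight_neg (t x : ℝ) :
    fourierIncrementWeight (-t) (-x) = fourierIncrementWeight t x := by
  simp [fourierIncrementWeight]

theorem fourierIncrementWeight_le_sq (t : ℝ) {x : ℝ} (hx : 0 < x) :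
    fourierIncrementWeight t x ≤ t ^ 2 := by
  have h : ‖Complex.exp (Complex.I * t * x) - 1‖ ≤ |t| * x := by
    have := Real.norm_exp_I_mul_ofReal_sub_one_le (x := t * x)
    rwa [Complex.ofReal_mul, ← mul_assoc, Real.norm_eq_abs, abs_mul, abs_of_pos hx] at this
  rw [fourierIncrementWeight, norm_div, Complex.norm_real, Real.norm_of_nonneg hx.le, ← sq_abs t]
  gcongr
  rwa [div_le_iff₀ hx]

theorem fourierIncrementWeight_le_rpow (t : ℝ) {x : ℝ} (hx : 0 < x) :
    fourierIncrementWeight t x ≤ 4 * x ^ (-2 : ℝ) := by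
  have h : ‖Complex.exp (Complex.I * t * x) - 1‖ ≤ 2 := by
    refine (norm_sub_le _ _).trans ?_
    have : ‖Complex.exp (Complex.I * t * x)‖ = 1 := by
      rw [Complex.norm_exp]; simp
    rw [this]
    norm_num
  rw [fourierIncrementWeight, norm_div, Complex.norm_real, Real.norm_of_nonneg hx.le, div_pow,
    Real.rpow_neg hx.le, Real.rpow_two, ← div_eq_mul_inv]
  gcongr
  nlinarith [norm_nonneg (Complex.exp (Complex.I * t * x) - 1)]

theorem integrable_weight_mul_matPosPow {n : ℕ} {B : Matrix (Fin n) (Fin n) ℂ}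
    (hB : ∀ μ ∈ spectrum ℂ B, -(1 / 2) < μ.re ∧ μ.re < 1 / 2) (t : ℝ) (c : ℂ) (i k l j : Fin n) :
    Integrable fun x : ℝ =>
      (fourierIncrementWeight t x : ℂ) * (matPosPow x B i k * c * star (matPosPow x B j l)) := by
  have hmeas : Measurable fun x : ℝ =>
      (fourierIncrementWeight t x : ℂ) * (matPosPow x B i k * c * star (matPosPow x B j l)) := by
    have h1 := measurable_fourierIncrementWeight t
    have h2 := measurable_matPosPow_apply B i k
    have h3 := measurable_matPosPow_apply B j l
    exact (Complex.measurable_ofReal.comp h1).mul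
      ((h2.mul_const c).mul (continuous_star.measurable.comp h3))
  have hnorm : ∀ (x w C₁ C₂ a b : ℝ), 0 < x → fourierIncrementWeight t x ≤ w →
      ‖matPosPow x B i k‖ ≤ C₁ * x ^ a → ‖matPosPow x B j l‖ ≤ C₂ * x ^ b →
      ‖(fourierIncrementWeight t x : ℂ) * (matPosPow x B i k * c * star (matPosPow x B j l))‖ ≤
        w * (C₁ * ‖c‖ * C₂ * x ^ (a + b)) := by
    intro x w C₁ C₂ a b hx hw h1 h2
    rw [norm_mul, norm_mul, norm_mul, norm_star, Complex.norm_real,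
      Real.norm_of_nonneg (fourierIncrementWeight_nonneg t x), Real.rpow_add hx]
    calc _ ≤ w * (C₁ * x ^ a * ‖c‖ * (C₂ * x ^ b)) := by
          have := (norm_nonneg _).trans h1
          have := (fourierIncrementWeight_nonneg t x).trans hw
          gcongr
      _ = _ := by ring
  rw [← integrableOn_univ, ← Set.Iic_union_Ioi (a := (0 : ℝ)),
    ← Set.Ioc_union_Ioi_eq_Ioi (zero_le_one' ℝ)]
  refine IntegrableOn.union ?_ (IntegrableOn.union ?_ ?_)
  · refine integrableOn_zero.congr_fun (fun x hx => ?_) measurableSet_Iic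
    have : ¬ 0 < x := not_lt.2 hx
    simp [matPosPow, this]
  · obtain ⟨a, ha, C₁, h1⟩ := exists_norm_matPosPow_le_of_le_one (fun μ hμ => (hB μ hμ).1) i k
    obtain ⟨b, hb, C₂, h2⟩ := exists_norm_matPosPow_le_of_le_one (fun μ hμ => (hB μ hμ).1) j l
    have hint : IntegrableOn (fun x : ℝ => t ^ 2 * (C₁ * ‖c‖ * C₂ * x ^ (a + b)))
        (Set.Ioc 0 1) := by
      refine Integrable.const_mul (Integrable.const_mul ?_ _) _
      exact (intervalIntegrable_iff_integrableOn_Ioc_of_le zero_le_one).1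
        (intervalIntegral.intervalIntegrable_rpow' (by linarith))
    refine Integrable.mono' hint hmeas.aestronglyMeasurable ?_
    refine (ae_restrict_iff' measurableSet_Ioc).2 (ae_of_all _ fun x hx => ?_)
    exact hnorm x _ _ _ _ _ hx.1 (fourierIncrementWeight_le_sq t hx.1) (h1 x hx.1 hx.2)
      (h2 x hx.1 hx.2)
  · obtain ⟨a, ha, C₁, h1⟩ := exists_norm_matPosPow_le_of_one_le (fun μ hμ => (hB μ hμ).2) i k
    obtain ⟨b, hb, C₂, h2⟩ := exists_norm_matPosPow_le_of_one_le (fun μ hμ => (hB μ hμ).2) j l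
    have hint : IntegrableOn (fun x : ℝ => (4 * (C₁ * ‖c‖ * C₂)) * x ^ (-2 + (a + b)))
        (Set.Ioi 1) :=
      Integrable.const_mul (integrableOn_Ioi_rpow_of_lt (by linarith) one_pos) _
    refine Integrable.mono' hint hmeas.aestronglyMeasurable ?_
    refine (ae_restrict_iff' measurableSet_Ioi).2 (ae_of_all _ fun x (hx : 1 < x) => ?_)
    have hx0 : 0 < x := by linarith
    refine (hnorm x _ _ _ _ _ hx0 (fourierIncrementWeight_le_rpow t hx0) (h1 x hx.le)
      (h2 x hx.le)).trans_eq ?_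
    rw [Real.rpow_add hx0 (-2) (a + b)]
    ring

theorem integrable_weight_smul_matPosPow_sandwich {n : ℕ} {B : Matrix (Fin n) (Fin n) ℂ}
    (hB : ∀ μ ∈ spectrum ℂ B, -(1 / 2) < μ.re ∧ μ.re < 1 / 2) (S : Matrix (Fin n) (Fin n) ℂ)
    (t : ℝ) (i j : Fin n) :
    Integrable fun x : ℝ =>
      (fourierIncrementWeight t x : ℂ) * (matPosPow x B * S * matPosPow x Bᴴ) i j := by
  have h : (fun x : ℝ =>
      (fourierIncrementWeight t x : ℂ) * (matPosPow x B * S * matPosPow x Bᴴ) i j) =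
      fun x => ∑ l, ∑ k, (fourierIncrementWeight t x : ℂ) *
        (matPosPow x B i k * S k l * star (matPosPow x B j l)) := by
    ext x
    simp only [Matrix.mul_apply, matPosPow_conjTranspose, Matrix.conjTranspose_apply,
      Finset.sum_mul, Finset.mul_sum]
  rw [h]
  exact integrable_finsetSum _ fun l _ => integrable_finsetSum _ fun k _ =>
    integrable_weight_mul_matPosPow hB t (S k l) i k l j

/-- If all eigenvalues `h` of the real matrix `H` satisfy `0 < Re h < 1` and
`D = H - (1/2) I`, then for every `t ∈ ℝ` every entry of the matrix-valued function
`x ↦ |(e^{itx}-1)/x|² (x₊^{-D} (AA^*) x₊^{-D^*} + x₋^{-D} (conj (AA^*)) x₋^{-D^*})`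
is Lebesgue integrable on `ℝ`. -/
theorem stmt6 (n : ℕ) (H : Matrix (Fin n) (Fin n) ℝ)
    (hH : ∀ h ∈ spectrum ℂ (H.map (Complex.ofReal)), 0 < h.re ∧ h.re < 1)
    (D : Matrix (Fin n) (Fin n) ℂ)
    (hD : D = H.map (Complex.ofReal) - (1/2 : ℂ) • 1)
    (A : Matrix (Fin n) (Fin n) ℂ) (t : ℝ) :
    ∀ i j : Fin n, Integrable (fun x : ℝ => specKernel D A t x i j) := by
  intro i j
  have hB : ∀ μ ∈ spectrum ℂ (-D), -(1 / 2) < μ.re ∧ μ.re < 1 / 2 := by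
    intro μ hμ
    rw [← spectrum.neg_eq, Set.mem_neg, hD, ← Algebra.algebraMap_eq_smul_one,
      ← spectrum.sub_singleton_eq, Set.sub_singleton] at hμ
    obtain ⟨h, hh, hμ⟩ := hμ
    have h1 := hH h hh
    have h2 := congrArg Complex.re hμ
    norm_num at h2
    constructor <;> linarith [h1.1, h1.2]
  have hpos := integrable_weight_smul_matPosPow_sandwich hB (A * Aᴴ) t i j
  have hneg := (integrable_weight_smul_matPosPow_sandwich hB
    ((A * Aᴴ).map (starRingEnd ℂ)) (-t) i j).comp_neg
  refine (hpos.add hneg).congr (ae_of_all _ fun x => ?_)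
  simp only [Pi.add_apply, fourierIncrementWeight_neg, Matrix.conjTranspose_neg]
  rw [specKernel, Matrix.smul_apply, Matrix.add_apply, smul_eq_mul, mul_add]
  rfl
end

section
/- Let H be an n×n real matrix all of whose (complex) eigenvalues h satisfy 1/2 < Re(h) < 1, let D := H − (1/2)I, and let A be an n×n complex matrix. For y ∈ ℝ set h_A(y) := y_+^{−D} (AA^*) y_+^{−D^*} + y_−^{−D} (\overline{AA^*}) y_−^{−D^*}. Then sup over x ∈ [−π, π] of Σ_{k∈ℤ, k≠0} |x + 2πk|^{−2} · ‖h_A(x + 2πk)‖ is finite (in particular the series converges for every such x). -/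
open MeasureTheory Matrix

attribute [local instance] Matrix.normedAddCommGroup

/-- `h_A(y) = y₊^{-D} (AA^*) y₊^{-D^*} + y₋^{-D} (conj (AA^*)) y₋^{-D^*}`. -/
noncomputable def hA {n : ℕ} (D : Matrix (Fin n) (Fin n) ℂ)
    (A : Matrix (Fin n) (Fin n) ℂ) (y : ℝ) : Matrix (Fin n) (Fin n) ℂ :=
  matPosPow y (-D) * (A * Aᴴ) * matPosPow y (-Dᴴ) +
    matPosPow (-y) (-D) * (A * Aᴴ).map (starRingEnd ℂ) * matPosPow (-y) (-Dᴴ)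

open Module

section MatrixSemigroup

variable {n : ℕ}

theorem Matrix.hasSum_exp_smul_mulVec (z : ℂ) (M : Matrix (Fin n) (Fin n) ℂ) (v : Fin n → ℂ) :
    HasSum (fun j : ℕ => ((j.factorial : ℂ)⁻¹ * z ^ j) • (M ^ j) *ᵥ v)
      (NormedSpace.exp (z • M) *ᵥ v) := by
  have h : HasSum (fun j : ℕ => (j.factorial : ℂ)⁻¹ • (z • M) ^ j) (NormedSpace.exp (z • M)) := by
    let _ : NormedRing (Matrix (Fin n) (Fin n) ℂ) := Matrix.linftyOpNormedRing
    let _ : NormedAlgebra ℂ (Matrix (Fin n) (Fin n) ℂ) := Matrix.linftyOpNormedAlgebra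
    exact @NormedSpace.exp_series_hasSum_exp' ℂ _ _ _ _ _ _
      (inferInstanceAs (CompleteSpace (Fin n → Fin n → ℂ))) (z • M)
  have hc : Continuous fun N : Matrix (Fin n) (Fin n) ℂ => N *ᵥ v := by fun_prop
  have h' := h.map (AddMonoidHom.mk' (fun N : Matrix (Fin n) (Fin n) ℂ => N *ᵥ v)
    fun a b => Matrix.add_mulVec a b v) hc
  refine (congrArg (HasSum · _) (funext fun j => ?_)).mpr h'
  simp [smul_pow, Matrix.smul_mulVec, mul_smul]

theorem Matrix.exp_smul_eq_smul_exp_sub (z μ : ℂ) (B : Matrix (Fin n) (Fin n) ℂ) :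
    NormedSpace.exp (z • B) =
      Complex.exp (z * μ) • NormedSpace.exp (z • (B - μ • (1 : Matrix (Fin n) (Fin n) ℂ))) := by
  have h1 : z • B = (z * μ) • (1 : Matrix (Fin n) (Fin n) ℂ) + z • (B - μ • 1) := by
    rw [smul_sub, smul_smul]; abel
  rw [h1, Matrix.exp_add_of_commute _ _ ((Commute.one_left _).smul_left _),
    Matrix.smul_one_eq_diagonal, Matrix.exp_diagonal, Pi.exp_def, ← Complex.exp_eq_exp_ℂ,
    ← Matrix.smul_one_eq_diagonal, smul_mul_assoc, one_mul]

/-- The vectors whose orbit under the semigroup `exp (t B)`, `t ≥ 0`, is bounded. -/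
def boundedOrbit (B : Matrix (Fin n) (Fin n) ℂ) : Submodule ℂ (Fin n → ℂ) where
  carrier := {v | ∃ C : ℝ, ∀ t : ℝ, 0 ≤ t → ‖NormedSpace.exp ((t : ℂ) • B) *ᵥ v‖ ≤ C}
  zero_mem' := ⟨0, fun t _ => by simp⟩
  add_mem' := by
    rintro v w ⟨C, hC⟩ ⟨C', hC'⟩
    refine ⟨C + C', fun t ht => ?_⟩
    rw [Matrix.mulVec_add]
    exact (norm_add_le _ _).trans (add_le_add (hC t ht) (hC' t ht))
  smul_mem' := by
    rintro c v ⟨C, hC⟩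
    refine ⟨‖c‖ * C, fun t ht => ?_⟩
    rw [Matrix.mulVec_smul, norm_smul]
    exact mul_le_mul_of_nonneg_left (hC t ht) (norm_nonneg c)

theorem exp_neg_mul_pow_div_factorial_le {c t : ℝ} (hc : 0 < c) (ht : 0 ≤ t) (j : ℕ) :
    Real.exp (-(c * t)) * ((j.factorial : ℝ)⁻¹ * t ^ j) ≤ (c ^ j)⁻¹ := by
  have h := Real.pow_div_factorial_le_exp (c * t) (by positivity) j
  rw [Real.exp_neg, inv_mul_le_iff₀ (Real.exp_pos _), ← div_eq_mul_inv,
    le_div_iff₀ (by positivity)]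
  calc _ = (c * t) ^ j / j.factorial := by rw [mul_pow]; ring
    _ ≤ _ := h

theorem maxGenEigenspace_le_boundedOrbit (B : Matrix (Fin n) (Fin n) ℂ) {μ : ℂ} (hμ : μ.re < 0) :
    End.maxGenEigenspace (Matrix.toLin' B) μ ≤ boundedOrbit B := by
  intro v hv
  obtain ⟨k, hk⟩ := (End.mem_maxGenEigenspace _ _ _).1 hv
  set N : Matrix (Fin n) (Fin n) ℂ := B - μ • 1 with hN
  have hNk : N ^ k *ᵥ v = 0 := by
    rwa [show Matrix.toLin' B - μ • (1 : End ℂ (Fin n → ℂ)) = Matrix.toLin' N by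
      simp [hN, End.one_eq_id], ← Matrix.toLin'_pow, Matrix.toLin'_apply] at hk
  refine ⟨∑ j ∈ Finset.range k, ((-μ.re) ^ j)⁻¹ * ‖N ^ j *ᵥ v‖, fun t ht => ?_⟩
  have hsum : NormedSpace.exp ((t : ℂ) • N) *ᵥ v =
      ∑ j ∈ Finset.range k, ((j.factorial : ℂ)⁻¹ * (t : ℂ) ^ j) • (N ^ j) *ᵥ v := by
    refine (Matrix.hasSum_exp_smul_mulVec (t : ℂ) N v).unique
      (hasSum_sum_of_ne_finset_zero fun j hj => ?_)
    obtain ⟨i, rfl⟩ := Nat.exists_eq_add_of_le (not_lt.1 (fun h => hj (Finset.mem_range.2 h)))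
    rw [add_comm, pow_add N, ← Matrix.mulVec_mulVec, hNk, Matrix.mulVec_zero, smul_zero]
  rw [Matrix.exp_smul_eq_smul_exp_sub _ μ, Matrix.smul_mulVec, ← hN, hsum, Finset.smul_sum]
  refine (norm_sum_le _ _).trans (Finset.sum_le_sum fun j _ => ?_)
  rw [norm_smul, norm_smul, ← mul_assoc]
  refine mul_le_mul_of_nonneg_right ?_ (norm_nonneg _)
  have h := exp_neg_mul_pow_div_factorial_le (neg_pos.2 hμ) ht j
  rw [Complex.norm_exp, norm_mul, norm_inv, norm_pow, Complex.norm_natCast, Complex.norm_real,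
    Real.norm_of_nonneg ht]
  have hre : ((t : ℂ) * μ).re = -(-μ.re * t) := by simp [mul_comm]
  rwa [hre]

theorem boundedOrbit_eq_top (B : Matrix (Fin n) (Fin n) ℂ) (hB : ∀ μ ∈ spectrum ℂ B, μ.re < 0) :
    boundedOrbit B = ⊤ := by
  rw [eq_top_iff, ← End.iSup_maxGenEigenspace_eq_top (Matrix.toLin' B)]
  refine iSup_le fun μ => ?_
  by_cases h : End.HasUnifEigenvalue (Matrix.toLin' B) μ ⊤
  · refine maxGenEigenspace_le_boundedOrbit B (hB μ ?_)
    rw [← Matrix.spectrum_toLin']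
    exact ((End.hasUnifEigenvalue_iff_hasUnifEigenvalue_one ENat.top_pos).1 h).mem_spectrum
  · rw [End.HasUnifEigenvalue, not_not] at h
    exact h.le.trans bot_le

/-- If the spectrum of `B` lies in the open left half-plane, `exp (t B)` is bounded on `t ≥ 0`. -/
theorem exists_norm_exp_smul_le (B : Matrix (Fin n) (Fin n) ℂ)
    (hB : ∀ μ ∈ spectrum ℂ B, μ.re < 0) :
    ∃ C : ℝ, 0 ≤ C ∧ ∀ t : ℝ, 0 ≤ t → ‖NormedSpace.exp ((t : ℂ) • B)‖ ≤ C := by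
  have h : ∀ j : Fin n, ∃ C : ℝ, ∀ t : ℝ, 0 ≤ t →
      ‖NormedSpace.exp ((t : ℂ) • B) *ᵥ Pi.single j 1‖ ≤ C := fun j => by
    have : Pi.single j 1 ∈ boundedOrbit B := by rw [boundedOrbit_eq_top B hB]; trivial
    exact this
  choose C hC using h
  have hC0 : ∀ j, 0 ≤ C j := fun j => (norm_nonneg _).trans (hC j 0 le_rfl)
  have hs : 0 ≤ ∑ j, C j := Finset.sum_nonneg fun j _ => hC0 j
  refine ⟨∑ j, C j, hs, fun t ht => (Matrix.norm_le_iff hs).2 fun i j => ?_⟩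
  refine le_trans ?_ ((hC j t ht).trans
    (Finset.single_le_sum (fun j _ => hC0 j) (Finset.mem_univ j)))
  refine le_trans (le_of_eq ?_) (norm_le_pi_norm _ i)
  simp

end MatrixSemigroup

section Bounds

variable {n : ℕ}

theorem matPosPow_neg_conjTranspose (x : ℝ) (D : Matrix (Fin n) (Fin n) ℂ) :
    matPosPow x (-Dᴴ) = (matPosPow x (-D))ᴴ := by
  unfold matPosPow
  split_ifs
  · rw [← Matrix.exp_conjTranspose, Matrix.conjTranspose_smul, Matrix.conjTranspose_neg]
    simp
  · simp

theorem exists_norm_hA_le (D A : Matrix (Fin n) (Fin n) ℂ)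
    (hD : ∀ μ ∈ spectrum ℂ (-D), μ.re < 0) :
    ∃ K : ℝ, ∀ y : ℝ, 1 ≤ |y| → ‖hA D A y‖ ≤ K := by
  obtain ⟨C, hC0, hC⟩ := exists_norm_exp_smul_le (-D) hD
  have hpow : ∀ y : ℝ, 1 ≤ |y| → matPosPow y (-D) ∈ Metric.closedBall 0 C := fun y hy => by
    rw [mem_closedBall_zero_iff, matPosPow]
    split_ifs with h
    · exact hC _ (Real.log_nonneg (by rwa [abs_of_pos h] at hy))
    · simpa using hC0
  let f : Matrix (Fin n) (Fin n) ℂ × Matrix (Fin n) (Fin n) ℂ → Matrix (Fin n) (Fin n) ℂ :=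
    fun p => p.1 * (A * Aᴴ) * p.1ᴴ + p.2 * (A * Aᴴ).map (starRingEnd ℂ) * p.2ᴴ
  have hf : Continuous f := by fun_prop
  let _ : NormedSpace ℂ (Matrix (Fin n) (Fin n) ℂ) := Matrix.normedSpace
  have : ProperSpace (Matrix (Fin n) (Fin n) ℂ) := FiniteDimensional.proper ℂ _
  obtain ⟨K, hK⟩ := ((isCompact_closedBall (0 : Matrix (Fin n) (Fin n) ℂ) C).prod
    (isCompact_closedBall (0 : Matrix (Fin n) (Fin n) ℂ) C)).exists_bound_of_continuousOn
      hf.continuousOn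
  refine ⟨K, fun y hy => ?_⟩
  have h := hK (matPosPow y (-D), matPosPow (-y) (-D))
    ⟨hpow y hy, hpow (-y) (by rwa [abs_neg])⟩
  simpa only [hA, matPosPow_neg_conjTranspose, f] using h

theorem abs_intCast_le_abs_add_two_pi_mul {x : ℝ} (hx : x ∈ Set.Icc (-Real.pi) Real.pi) {k : ℤ}
    (hk : k ≠ 0) : |(k : ℝ)| ≤ |x + 2 * Real.pi * k| := by
  have hk1 : (1 : ℝ) ≤ |(k : ℝ)| := by exact_mod_cast Int.one_le_abs hk
  have hpi := Real.pi_gt_three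
  have hx' : |x| ≤ Real.pi := abs_le.2 hx
  have h : |2 * Real.pi * k| ≤ |x + 2 * Real.pi * k| + |x| := by
    simpa using abs_sub (x + 2 * Real.pi * k) x
  rw [abs_mul, abs_of_pos (by positivity : 0 < 2 * Real.pi)] at h
  nlinarith

end Bounds

/-- If all eigenvalues `h` of `H` satisfy `1/2 < Re h < 1` and `D = H - (1/2) I`, then
for every `x ∈ [-π,π]` the series `Σ_{k ≠ 0} |x + 2πk|^{-2} ‖h_A(x + 2πk)‖` converges,
and the supremum over `x ∈ [-π,π]` of its sum is finite. -/
theorem stmt10 (n : ℕ) (H : Matrix (Fin n) (Fin n) ℝ)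
    (hH : ∀ h ∈ spectrum ℂ (H.map (Complex.ofReal)), 1/2 < h.re ∧ h.re < 1)
    (D : Matrix (Fin n) (Fin n) ℂ)
    (hD : D = H.map (Complex.ofReal) - (1/2 : ℂ) • 1)
    (A : Matrix (Fin n) (Fin n) ℂ) :
    (∀ x ∈ Set.Icc (-Real.pi) Real.pi,
      Summable (fun k : {k : ℤ // k ≠ 0} =>
        (|x + 2 * Real.pi * ((k : ℤ) : ℝ)| ^ 2)⁻¹ * ‖hA D A (x + 2 * Real.pi * ((k : ℤ) : ℝ))‖)) ∧
    ∃ C : ℝ, ∀ x ∈ Set.Icc (-Real.pi) Real.pi,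
      (∑' k : {k : ℤ // k ≠ 0},
        (|x + 2 * Real.pi * ((k : ℤ) : ℝ)| ^ 2)⁻¹ * ‖hA D A (x + 2 * Real.pi * ((k : ℤ) : ℝ))‖)
        ≤ C := by
  have hspec : ∀ μ ∈ spectrum ℂ (-D), μ.re < 0 := fun μ hμ => by
    have h : (1 / 2 : ℂ) - μ ∈ spectrum ℂ (H.map Complex.ofReal) := by
      rw [spectrum.mem_iff] at hμ ⊢
      rw [← IsUnit.neg_iff] at hμ
      convert hμ using 2
      rw [hD, map_sub, Algebra.algebraMap_eq_smul_one, Algebra.algebraMap_eq_smul_one]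
      abel
    have := (hH _ h).1
    norm_num at this
    linarith
  obtain ⟨K, hK⟩ := exists_norm_hA_le D A hspec
  have hmaj : Summable fun k : {k : ℤ // k ≠ 0} => (((k : ℤ) : ℝ) ^ 2)⁻¹ * K := by
    have h : Summable fun k : ℤ => ((k : ℝ) ^ 2)⁻¹ * K := by
      simpa only [one_div] using (Real.summable_one_div_int_pow.2 one_lt_two).mul_right K
    exact h.subtype {k : ℤ | k ≠ 0}
  have hle : ∀ x ∈ Set.Icc (-Real.pi) Real.pi, ∀ k : {k : ℤ // k ≠ 0},
      (|x + 2 * Real.pi * ((k : ℤ) : ℝ)| ^ 2)⁻¹ * ‖hA D A (x + 2 * Real.pi * ((k : ℤ) : ℝ))‖ ≤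
        (((k : ℤ) : ℝ) ^ 2)⁻¹ * K := fun x hx k => by
    have hk1 : (1 : ℝ) ≤ |((k : ℤ) : ℝ)| := by exact_mod_cast Int.one_le_abs k.2
    have hk := abs_intCast_le_abs_add_two_pi_mul hx k.2
    rw [← sq_abs ((k : ℤ) : ℝ)]
    have := hK _ (hk1.trans hk)
    gcongr
  have hs : ∀ x ∈ Set.Icc (-Real.pi) Real.pi, Summable (fun k : {k : ℤ // k ≠ 0} =>
      (|x + 2 * Real.pi * ((k : ℤ) : ℝ)| ^ 2)⁻¹ *
        ‖hA D A (x + 2 * Real.pi * ((k : ℤ) : ℝ))‖) := fun x hx =>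
    hmaj.of_nonneg_of_le (fun k => by positivity) (hle x hx)
  exact ⟨hs, _, fun x hx => (hs x hx).tsum_le_tsum (hle x hx) hmaj⟩
end

section
/- Let X = (X(t))_{t∈ℝ} be an ℝ^n-valued stochastic process with E‖X(t)‖² < ∞ for all t, with X(0) = 0 almost surely, such that for all s,t ∈ ℝ the random vector X(t) − X(s) has the same distribution as X(t−s), and such that for all c > 0 and t ∈ ℝ the random vector X(ct) has the same distribution as c^H X(t), where H is an n×n real matrix and c^H := exp((log c)·H). Set Γ := E[X(1)X(1)ᵀ]. Then for all s, t ∈ ℝ: E[X(t)X(s)ᵀ] + E[X(s)X(t)ᵀ] = |t|^H Γ (|t|^H)ᵀ + |s|^H Γ (|s|^H)ᵀ − |t−s|^H Γ (|t−s|^H)ᵀ, where |r|^H := exp(log|r| · H) for r ≠ 0 and |0|^H := 0 (zero matrix). -/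
open MeasureTheory Matrix

/-- `|r|^H := exp((log |r|) H)` for `r ≠ 0`, and the zero matrix for `r = 0`. -/
noncomputable def matAbsPow {n : ℕ} (H : Matrix (Fin n) (Fin n) ℝ) (r : ℝ) :
    Matrix (Fin n) (Fin n) ℝ :=
  if r = 0 then 0 else NormedSpace.exp (Real.log |r| • H)

/-- The matrix of second moments `E[Y Yᵀ]` of a random vector `Y`. -/
noncomputable def secondMoment {Ω : Type*} [MeasurableSpace Ω] (μ : Measure Ω) {n : ℕ}
    (Y : Ω → Fin n → ℝ) : Matrix (Fin n) (Fin n) ℝ :=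
  Matrix.of fun i j => ∫ ω, Y ω i * Y ω j ∂μ

section SecondMoment

variable {Ω : Type*} [MeasurableSpace Ω] {μ : Measure Ω} {n : ℕ}

lemma secondMoment_eq_of_map_eq {Y Z : Ω → Fin n → ℝ} (hY : Measurable Y) (hZ : Measurable Z)
    (h : Measure.map Y μ = Measure.map Z μ) : secondMoment μ Y = secondMoment μ Z := by
  ext i j
  have hf (ν : Measure (Fin n → ℝ)) :
      AEStronglyMeasurable (fun x : Fin n → ℝ => x i * x j) ν := by
    fun_prop
  have h1 := integral_map hY.aemeasurable (hf (Measure.map Y μ))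
  have h2 := integral_map hZ.aemeasurable (hf (Measure.map Z μ))
  rw [h] at h1
  exact h1.symm.trans h2

lemma secondMoment_eq_zero_of_ae_eq_zero {Y : Ω → Fin n → ℝ} (h : ∀ᵐ ω ∂μ, Y ω = 0) :
    secondMoment μ Y = 0 := by
  ext i j
  refine integral_eq_zero_of_ae ?_
  filter_upwards [h] with ω hω
  simp [hω]

lemma secondMoment_mulVec (A : Matrix (Fin n) (Fin n) ℝ) {Y : Ω → Fin n → ℝ}
    (hY : ∀ i j, Integrable (fun ω => Y ω i * Y ω j) μ) :
    secondMoment μ (fun ω => A.mulVec (Y ω)) = A * secondMoment μ Y * Aᵀ := by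
  ext i j
  have hint (k l : Fin n) : Integrable (fun ω => A i k * A j l * (Y ω k * Y ω l)) μ :=
    (hY k l).const_mul _
  calc ∫ ω, A.mulVec (Y ω) i * A.mulVec (Y ω) j ∂μ
      = ∫ ω, ∑ l, ∑ k, A i k * A j l * (Y ω k * Y ω l) ∂μ := by
        refine integral_congr_ae (.of_forall fun ω => ?_)
        simp only [mulVec, dotProduct, Finset.sum_mul_sum]
        rw [Finset.sum_comm]
        exact Finset.sum_congr rfl fun l _ => Finset.sum_congr rfl fun k _ => by ring
    _ = ∑ l, ∑ k, A i k * A j l * ∫ ω, Y ω k * Y ω l ∂μ := by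
        rw [integral_finsetSum _ fun l _ => integrable_finsetSum _ fun k _ => hint k l]
        refine Finset.sum_congr rfl fun l _ => ?_
        rw [integral_finsetSum _ fun k _ => hint k l]
        exact Finset.sum_congr rfl fun k _ => integral_const_mul _ _
    _ = (A * secondMoment μ Y * Aᵀ) i j := by
        simp only [mul_apply, transpose_apply, secondMoment, of_apply, Finset.sum_mul]
        exact Finset.sum_congr rfl fun l _ => Finset.sum_congr rfl fun k _ => by ring

lemma secondMoment_sub {Y Z : Ω → Fin n → ℝ}
    (hY : ∀ i, MemLp (fun ω => Y ω i) 2 μ) (hZ : ∀ i, MemLp (fun ω => Z ω i) 2 μ) :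
    secondMoment μ (fun ω => Y ω - Z ω) = secondMoment μ Y + secondMoment μ Z -
      Matrix.of fun i j => (∫ ω, Y ω i * Z ω j ∂μ) + ∫ ω, Z ω i * Y ω j ∂μ := by
  ext i j
  have hYY : Integrable (fun ω => Y ω i * Y ω j) μ := (hY i).integrable_mul (hY j)
  have hZZ : Integrable (fun ω => Z ω i * Z ω j) μ := (hZ i).integrable_mul (hZ j)
  have hYZ : Integrable (fun ω => Y ω i * Z ω j) μ := (hY i).integrable_mul (hZ j)
  have hZY : Integrable (fun ω => Z ω i * Y ω j) μ := (hZ i).integrable_mul (hY j)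
  simp only [secondMoment, of_apply, Matrix.sub_apply, Matrix.add_apply]
  rw [← integral_add hYY hZZ, ← integral_add hYZ hZY,
    ← integral_sub (hYY.fun_add hZZ) (hYZ.fun_add hZY)]
  refine integral_congr_ae (.of_forall fun ω => ?_)
  simp only [Pi.sub_apply]
  ring

end SecondMoment

/-- Covariance identity for an operator self-similar process with stationary increments:
if `X(t) - X(s) ~ X(t-s)`, `X(ct) ~ c^H X(t)` for `c > 0`, `X(0) = 0` a.s. and all second
moments are finite, then with `Γ = E[X(1)X(1)ᵀ]`,
`E[X(t)X(s)ᵀ] + E[X(s)X(t)ᵀ]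
  = |t|^H Γ (|t|^H)ᵀ + |s|^H Γ (|s|^H)ᵀ - |t-s|^H Γ (|t-s|^H)ᵀ`. -/
theorem stmt13 {Ω : Type*} [MeasurableSpace Ω] (μ : Measure Ω) [IsProbabilityMeasure μ]
    (n : ℕ) (X : ℝ → Ω → (Fin n → ℝ)) (H : Matrix (Fin n) (Fin n) ℝ)
    (hmeas : ∀ t : ℝ, Measurable (X t))
    (hL2 : ∀ t : ℝ, ∀ i : Fin n, Integrable (fun ω => (X t ω i) ^ 2) μ)
    (h0 : ∀ᵐ ω ∂μ, X 0 ω = 0)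
    (hincr : ∀ s t : ℝ,
      Measure.map (fun ω => X t ω - X s ω) μ = Measure.map (X (t - s)) μ)
    (hss : ∀ c : ℝ, 0 < c → ∀ t : ℝ,
      Measure.map (X (c * t)) μ =
        Measure.map (fun ω => (NormedSpace.exp (Real.log c • H)).mulVec (X t ω)) μ)
    (G : Matrix (Fin n) (Fin n) ℝ)
    (hG : G = Matrix.of fun i j => ∫ ω, X 1 ω i * X 1 ω j ∂μ)
    (s t : ℝ) :
    (Matrix.of fun i j => (∫ ω, X t ω i * X s ω j ∂μ) + ∫ ω, X s ω i * X t ω j ∂μ) =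
      matAbsPow H t * G * (matAbsPow H t)ᵀ + matAbsPow H s * G * (matAbsPow H s)ᵀ -
        matAbsPow H (t - s) * G * (matAbsPow H (t - s))ᵀ := by
  have hLp (r : ℝ) (i : Fin n) : MemLp (fun ω => X r ω i) 2 μ :=
    (memLp_two_iff_integrable_sq
      ((measurable_pi_apply i).comp (hmeas r)).aestronglyMeasurable).2 (hL2 r i)
  have hpos (r : ℝ) (hr : 0 < r) :
      secondMoment μ (X r) = matAbsPow H r * G * (matAbsPow H r)ᵀ := by
    have hlaw := hss r hr 1
    rw [mul_one] at hlaw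
    have hmul : Measurable fun ω => (NormedSpace.exp (Real.log r • H)).mulVec (X 1 ω) :=
      (Continuous.matrix_mulVec continuous_const continuous_id).measurable.comp (hmeas 1)
    rw [secondMoment_eq_of_map_eq (hmeas r) hmul hlaw,
      secondMoment_mulVec _ fun i j => (hLp 1 i).integrable_mul (hLp 1 j),
      matAbsPow, if_neg hr.ne', abs_of_pos hr, hG]
    rfl
  have hneg (r : ℝ) : secondMoment μ (X (-r)) = secondMoment μ (X r) := by
    have hlaw := hincr r 0
    rw [zero_sub] at hlaw
    rw [← secondMoment_eq_of_map_eq ((hmeas 0).sub (hmeas r)) (hmeas (-r)) hlaw]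
    ext i j
    refine integral_congr_ae ?_
    filter_upwards [h0] with ω hω
    simp [hω]
  have hall (r : ℝ) : secondMoment μ (X r) = matAbsPow H r * G * (matAbsPow H r)ᵀ := by
    rcases lt_trichotomy r 0 with hr | rfl | hr
    · rw [← hneg, hpos (-r) (neg_pos.2 hr)]
      simp [matAbsPow]
    · simp [secondMoment_eq_zero_of_ae_eq_zero h0, matAbsPow]
    · exact hpos r hr
  rw [← hall t, ← hall s, ← hall (t - s),
    ← secondMoment_eq_of_map_eq ((hmeas t).sub (hmeas s)) (hmeas (t - s)) (hincr s t)]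
  change _ = _ - secondMoment μ (fun ω => X t ω - X s ω)
  rw [secondMoment_sub (hLp t) (hLp s), sub_sub_cancel]
end

section
/- Let X = (X(t))_{t∈ℝ} be an ℝ^n-valued centered Gaussian process with stationary increments, operator self-similar with exponent H = (1/2)I, proper, with X(0) = 0 almost surely and E‖X(t)‖² < ∞ for all t. (a) If X is time-reversible, then X has independent increments: for all t_0 < t_1 < … < t_m, the random vectors X(t_1) − X(t_0), …, X(t_m) − X(t_{m−1}) are mutually independent. (b) Conversely, if X has independent increments, then X is time-reversible. -/
open MeasureTheory

/-- Two `ℝ`-indexed processes have the same finite-dimensional distributions. -/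
def SameFDD {Ω : Type*} [MeasurableSpace Ω] (μ : Measure Ω) {E : Type*} [MeasurableSpace E]
    (X Y : ℝ → Ω → E) : Prop :=
  ∀ (m : ℕ) (ts : Fin m → ℝ),
    Measure.map (fun ω (k : Fin m) => X (ts k) ω) μ =
      Measure.map (fun ω (k : Fin m) => Y (ts k) ω) μ

/-- An `ℝⁿ`-valued process is a centered Gaussian process: every (finite) real linear
combination of its values is a centered real Gaussian random variable. -/
def IsCenteredGaussianProcess {Ω : Type*} [MeasurableSpace Ω] (μ : Measure Ω) {n : ℕ}
    (X : ℝ → Ω → (Fin n → ℝ)) : Prop :=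
  ∀ (m : ℕ) (ts : Fin m → ℝ) (a : Fin m → Fin n → ℝ),
    ∃ v : NNReal,
      Measure.map (fun ω => ∑ k : Fin m, ∑ i : Fin n, a k i * X (ts k) ω i) μ =
        ProbabilityTheory.gaussianReal 0 v

/-- A process has independent increments: for all `t₀ < t₁ < ⋯ < t_m` the increments
`X(t₁) - X(t₀), …, X(t_m) - X(t_{m-1})` are mutually independent. -/
def HasIndepIncrements {Ω : Type*} [MeasurableSpace Ω] (μ : Measure Ω) {n : ℕ}
    (X : ℝ → Ω → (Fin n → ℝ)) : Prop :=
  ∀ (m : ℕ) (t : Fin (m + 1) → ℝ), StrictMono t →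
    ProbabilityTheory.iIndepFun (m := fun _ : Fin m => (inferInstance : MeasurableSpace (Fin n → ℝ)))
      (fun (k : Fin m) ω => X (t k.succ) ω - X (t k.castSucc) ω) μ

open ProbabilityTheory

section CovarianceFunction

variable {g : ℝ → ℝ → ℝ}

lemma covFun_neg_diag (hl : ∀ t, g 0 t = 0) (hr : ∀ t, g t 0 = 0)
    (hst : ∀ h s t, g (s + h) (t + h) - g (s + h) h - g h (t + h) + g h h = g s t) (t : ℝ) :
    g (-t) (-t) = g t t := by
  have h := hst (-t) t t
  simpa [hl, hr] using h

lemma covFun_polarization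
    (hst : ∀ h s t, g (s + h) (t + h) - g (s + h) h - g h (t + h) + g h h = g s t) (s t : ℝ) :
    g s t + g t s = g s s + g t t - g (t - s) (t - s) := by
  have h := hst s (t - s) (t - s)
  simp only [sub_add_cancel] at h
  linarith

lemma covFun_even_of_symm (hl : ∀ t, g 0 t = 0) (hr : ∀ t, g t 0 = 0)
    (hst : ∀ h s t, g (s + h) (t + h) - g (s + h) h - g h (t + h) + g h h = g s t)
    (hsymm : ∀ s t, g s t = g t s) (s t : ℝ) : g (-s) (-t) = g s t := by
  have h1 := covFun_polarization hst s t
  have h2 := covFun_polarization hst (-s) (-t)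
  rw [show -t - -s = -(t - s) by ring] at h2
  simp only [covFun_neg_diag hl hr hst] at h2
  linarith [hsymm s t, hsymm (-s) (-t)]

/-- The antisymmetric part of an even covariance function `g` is, after the substitution
`(x, y) ↦ (x, x + y)`, biadditive; homogeneity of degree one then forces it to vanish. -/
lemma covFun_symm_of_even (hl : ∀ t, g 0 t = 0) (hr : ∀ t, g t 0 = 0)
    (hst : ∀ h s t, g (s + h) (t + h) - g (s + h) h - g h (t + h) + g h h = g s t)
    (hss : ∀ c, 0 < c → ∀ s t, g (c * s) (c * t) = c * g s t)
    (heven : ∀ s t, g (-s) (-t) = g s t) (s t : ℝ) : g s t = g t s := by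
  set f : ℝ → ℝ → ℝ := fun x y => g x (x + y) - g (x + y) x with hf
  have hcocycle : ∀ x y z, f y z - f (x + y) z + f x (y + z) - f x y = 0 := by
    intro x y z
    have h1 := hst x y (y + z)
    have h2 := hst x (y + z) y
    simp only [hf, ← add_assoc]
    rw [show y + z + x = x + y + z by ring, show y + x = x + y by ring] at h1 h2
    linarith
  have halt : ∀ x y, f x y = - f y x := by
    intro x y
    have h1 := hst (-(x + y)) x (x + y)
    have h2 := hst (-(x + y)) (x + y) x
    rw [show x + -(x + y) = -y by ring, add_neg_cancel] at h1 h2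
    simp only [hf, hl, hr, heven] at h1 h2 ⊢
    rw [add_comm y x]
    linarith
  have hadd : ∀ x y z, f (x + y) z = f x z + f y z := by
    intro x y z
    have h1 := hcocycle x y z
    have h2 := hcocycle x z y
    have h3 := hcocycle z x y
    rw [add_comm z y] at h2
    rw [add_comm z x] at h3
    linarith [halt x z, halt y z, halt z x, halt (x + y) z]
  have hscale : ∀ x y, f (2 * x) (2 * y) = 2 * f x y := by
    intro x y
    simp only [hf, ← mul_add, hss 2 two_pos]
    ring
  have hzero : f s (t - s) = 0 := by
    have h1 := hadd s s (2 * (t - s))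
    have h2 := hadd (t - s) (t - s) s
    rw [← two_mul] at h1 h2
    linarith [hscale s (t - s), halt s (2 * (t - s)), halt s (t - s)]
  simp only [hf, add_sub_cancel] at hzero
  linarith

lemma covFun_diag (hl : ∀ t, g 0 t = 0) (hr : ∀ t, g t 0 = 0)
    (hst : ∀ h s t, g (s + h) (t + h) - g (s + h) h - g h (t + h) + g h h = g s t)
    (hss : ∀ c, 0 < c → ∀ s t, g (c * s) (c * t) = c * g s t) (t : ℝ) :
    g t t = |t| * g 1 1 := by
  rcases lt_trichotomy t 0 with h | h | h
  · have := hss (-t) (by linarith) 1 1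
    rw [mul_one, covFun_neg_diag hl hr hst] at this
    rw [this, abs_of_neg h]
  · simp [h, hl]
  · have := hss t h 1 1
    rw [mul_one] at this
    rw [this, abs_of_pos h]

lemma covFun_increments_eq_zero (hl : ∀ t, g 0 t = 0) (hr : ∀ t, g t 0 = 0)
    (hst : ∀ h s t, g (s + h) (t + h) - g (s + h) h - g h (t + h) + g h h = g s t)
    (hss : ∀ c, 0 < c → ∀ s t, g (c * s) (c * t) = c * g s t)
    (hsymm : ∀ s t, g s t = g t s) {a b c d : ℝ} (hab : a ≤ b) (hbc : b ≤ c) (hcd : c ≤ d) :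
    g b d - g b c - g a d + g a c = 0 := by
  have key : ∀ s t, s ≤ t → g s t = (|s| + |t| - (t - s)) / 2 * g 1 1 := by
    intro s t h
    have h1 := covFun_polarization hst s t
    rw [covFun_diag hl hr hst hss s, covFun_diag hl hr hst hss t,
      covFun_diag hl hr hst hss (t - s), ← hsymm s t, abs_of_nonneg (sub_nonneg.2 h)] at h1
    linarith
  rw [key b d (hbc.trans hcd), key b c hbc, key a d (hab.trans (hbc.trans hcd)),
    key a c (hab.trans hbc)]
  ring

lemma covFun_symm_of_increments (hl : ∀ t, g 0 t = 0) (hr : ∀ t, g t 0 = 0)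
    (h₁ : ∀ a b c, a < b → b < c → g b c - g b b - g a c + g a b = 0)
    (h₂ : ∀ a b c, a < b → b < c → g c b - g b b - g c a + g b a = 0) (s t : ℝ) :
    g s t = g t s := by
  wlog hst : s < t generalizing s t
  · rcases (not_lt.1 hst).lt_or_eq with h | h
    · exact (this t s h).symm
    · rw [h]
  rcases lt_trichotomy 0 s with h | h | h
  · linarith [h₁ 0 s t h hst, h₂ 0 s t h hst, hl s, hr s, hl t, hr t]
  · rw [← h, hl, hr]
  · rcases lt_trichotomy 0 t with h' | h' | h'
    · linarith [h₁ s 0 t h h', h₂ s 0 t h h', hl s, hr s, hl t, hr t, hl 0]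
    · rw [← h', hl, hr]
    · linarith [h₁ s t 0 hst h', h₂ s t 0 hst h', hl s, hr s, hl t, hr t]

end CovarianceFunction

section GaussianProcesses

variable {Ω : Type*} [MeasurableSpace Ω] {μ : Measure Ω} {n : ℕ}

lemma SameFDD.covariance_eq {X Y : ℝ → Ω → (Fin n → ℝ)} (h : SameFDD μ X Y)
    (hX : ∀ t, Measurable (X t)) (hY : ∀ t, Measurable (Y t)) (i j : Fin n) (s t : ℝ) :
    cov[fun ω => X s ω i, fun ω => X t ω j; μ] = cov[fun ω => Y s ω i, fun ω => Y t ω j; μ] := by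
  have h2 := h 2 ![s, t]
  have key : ∀ Z : ℝ → Ω → (Fin n → ℝ), (∀ t, Measurable (Z t)) →
      cov[fun ω => Z s ω i, fun ω => Z t ω j; μ] =
        cov[fun x : Fin 2 → Fin n → ℝ => x 0 i, fun x => x 1 j;
          μ.map (fun ω (k : Fin 2) => Z (![s, t] k) ω)] := by
    intro Z hZ
    rw [covariance_map]
    · rfl
    · exact Measurable.aestronglyMeasurable (by fun_prop)
    · exact Measurable.aestronglyMeasurable (by fun_prop)
    · exact (measurable_pi_lambda _ fun k => hZ _).aemeasurable
  rw [key X hX, key Y hY, h2]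

lemma dual_apply_eq_sum {m : ℕ} (L : StrongDual ℝ (Fin m → Fin n → ℝ)) (x : Fin m → Fin n → ℝ) :
    L x = ∑ k, ∑ i, L (Pi.single k (Pi.single i 1)) * x k i := by
  conv_lhs => rw [← Finset.univ_sum_single x]
  rw [map_sum]
  refine Finset.sum_congr rfl fun k _ => ?_
  conv_lhs => rw [← Finset.univ_sum_single (x k)]
  have : Pi.single k (∑ i, Pi.single i (x k i)) =
      ∑ i, x k i • (Pi.single k (Pi.single i 1) : Fin m → Fin n → ℝ) := by
    ext l j
    by_cases hl : l = k
    · subst hl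
      simp [Finset.sum_apply, Pi.single_apply]
    · simp [Finset.sum_apply, hl]
  rw [this, map_sum]
  simp [mul_comm]

lemma IsCenteredGaussianProcess.hasGaussianLaw {X : ℝ → Ω → (Fin n → ℝ)}
    (hX : IsCenteredGaussianProcess μ X) (hmeas : ∀ t, Measurable (X t)) {m : ℕ}
    (ts : Fin m → ℝ) : HasGaussianLaw (fun ω (k : Fin m) => X (ts k) ω) μ := by
  refine ⟨isGaussian_of_map_eq_gaussianReal fun L => ?_⟩
  obtain ⟨v, hv⟩ := hX m ts fun k i => L (Pi.single k (Pi.single i 1))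
  refine ⟨0, v, ?_⟩
  rw [Measure.map_map (by fun_prop) (measurable_pi_lambda _ fun k => hmeas _), ← hv]
  congr 1
  ext ω
  exact dual_apply_eq_sum L _

lemma IsCenteredGaussianProcess.memLp_two {X : ℝ → Ω → (Fin n → ℝ)}
    (hX : IsCenteredGaussianProcess μ X) (hmeas : ∀ t, Measurable (X t)) (t : ℝ) (i : Fin n) :
    MemLp (fun ω => X t ω i) 2 μ :=
  (((hX.hasGaussianLaw hmeas fun _ : Fin 1 => t).eval 0).eval i).memLp_two

lemma IsCenteredGaussianProcess.integral_dual_eq_zero {X : ℝ → Ω → (Fin n → ℝ)}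
    (hX : IsCenteredGaussianProcess μ X) (hmeas : ∀ t, Measurable (X t)) {m : ℕ}
    (ts : Fin m → ℝ) (L : StrongDual ℝ (Fin m → Fin n → ℝ)) :
    ∫ ω, L (fun k => X (ts k) ω) ∂μ = 0 := by
  obtain ⟨v, hv⟩ := hX m ts fun k i => L (Pi.single k (Pi.single i 1))
  rw [integral_congr_ae (.of_forall fun ω => dual_apply_eq_sum L _)]
  have h := integral_id_gaussianReal (μ := 0) (v := v)
  rw [← hv, integral_map _ (by fun_prop)] at h
  · exact h
  · exact Measurable.aemeasurable (by fun_prop)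

/-- The finite-dimensional laws of a centered Gaussian process are determined by its
covariance function. -/
lemma IsCenteredGaussianProcess.map_eq_of_covariance_eq [IsProbabilityMeasure μ]
    {X : ℝ → Ω → (Fin n → ℝ)}
    (hX : IsCenteredGaussianProcess μ X) (hmeas : ∀ t, Measurable (X t)) {m : ℕ}
    (ts us : Fin m → ℝ)
    (hcov : ∀ k l i j, cov[fun ω => X (ts k) ω i, fun ω => X (ts l) ω j; μ] =
      cov[fun ω => X (us k) ω i, fun ω => X (us l) ω j; μ]) :
    μ.map (fun ω (k : Fin m) => X (ts k) ω) = μ.map (fun ω (k : Fin m) => X (us k) ω) := by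
  have hts := hX.hasGaussianLaw hmeas ts
  have hus := hX.hasGaussianLaw hmeas us
  refine Measure.ext_of_charFunDual ?_
  ext L
  have hvar : ∀ rs : Fin m → ℝ, Var[fun ω => L (fun k => X (rs k) ω); μ] =
      ∑ p : Fin m × Fin n, ∑ q : Fin m × Fin n, L (Pi.single p.1 (Pi.single p.2 1)) *
        (L (Pi.single q.1 (Pi.single q.2 1)) *
          cov[fun ω => X (rs p.1) ω p.2, fun ω => X (rs q.1) ω q.2; μ]) := by
    intro rs
    have hsum : (fun ω => L (fun k => X (rs k) ω)) = fun ω => ∑ p : Fin m × Fin n,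
        L (Pi.single p.1 (Pi.single p.2 1)) * X (rs p.1) ω p.2 := by
      ext ω
      rw [dual_apply_eq_sum, Fintype.sum_prod_type]
    have hmem : ∀ p : Fin m × Fin n,
        MemLp (fun ω => L (Pi.single p.1 (Pi.single p.2 1)) * X (rs p.1) ω p.2) 2 μ :=
      fun p => (hX.memLp_two hmeas _ _).const_mul _
    rw [hsum, ← covariance_self (Finset.aemeasurable_fun_sum _ fun p _ => (hmem p).aemeasurable),
      covariance_fun_sum_fun_sum hmem hmem]
    simp_rw [covariance_const_mul_left, covariance_const_mul_right]
  rw [hts.charFunDual_map_eq_fun, hus.charFunDual_map_eq_fun,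
    hX.integral_dual_eq_zero hmeas, hX.integral_dual_eq_zero hmeas, hvar, hvar]
  simp_rw [hcov]

lemma covariance_increments [IsFiniteMeasure μ] {X : ℝ → Ω → (Fin n → ℝ)}
    (hX : ∀ t i, MemLp (fun ω => X t ω i) 2 μ) (i j : Fin n) (a b c d : ℝ) :
    cov[fun ω => (X b ω - X a ω) i, fun ω => (X d ω - X c ω) j; μ] =
      cov[fun ω => X b ω i, fun ω => X d ω j; μ] - cov[fun ω => X b ω i, fun ω => X c ω j; μ] -
      cov[fun ω => X a ω i, fun ω => X d ω j; μ] + cov[fun ω => X a ω i, fun ω => X c ω j; μ] := by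
  simp only [Pi.sub_apply]
  rw [covariance_fun_sub_left (hX _ _) (hX _ _) (show MemLp (fun ω => X d ω j - X c ω j) 2 μ from (hX d j).sub (hX c j)),
    covariance_fun_sub_right (hX _ _) (hX _ _) (hX _ _),
    covariance_fun_sub_right (hX _ _) (hX _ _) (hX _ _)]
  ring

end GaussianProcesses

/-- Let `X` be an `ℝⁿ`-valued centered Gaussian process with stationary increments,
continuous in law, operator self-similar with exponent `H = (1/2) I`, proper, with
`X(0) = 0` a.s. and finite second moments. Then `X` is time-reversible if and only if `X`
has independent increments. -/
theorem stmt16 {Ω : Type*} [MeasurableSpace Ω] (μ : Measure Ω) [IsProbabilityMeasure μ]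
    (n : ℕ) (X : ℝ → Ω → (Fin n → ℝ))
    (hmeas : ∀ t : ℝ, Measurable (X t))
    (hgauss : IsCenteredGaussianProcess μ X)
    (hL2 : ∀ t : ℝ, ∀ i : Fin n, Integrable (fun ω => (X t ω i) ^ 2) μ)
    (h0 : ∀ᵐ ω ∂μ, X 0 ω = 0)
    (hincr : ∀ h : ℝ,
      SameFDD μ (fun t ω => X (t + h) ω - X h ω) (fun t ω => X t ω - X 0 ω))
    (hcont : ∀ f : BoundedContinuousFunction (Fin n → ℝ) ℝ,
      Continuous fun t : ℝ => ∫ ω, f (X t ω) ∂μ)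
    (hss : ∀ c : ℝ, 0 < c →
      SameFDD μ (fun t => X (c * t)) (fun t ω => Real.sqrt c • X t ω))
    (hproper : ∀ t : ℝ, t ≠ 0 → ∀ v : Fin n → ℝ, v ≠ 0 →
      ¬ (∀ᵐ ω ∂μ, (∑ i : Fin n, v i * X t ω i) = 0)) :
    SameFDD μ (fun t => X (-t)) X ↔ HasIndepIncrements μ X := by
  have hmem := hgauss.memLp_two hmeas
  set γ : Fin n → Fin n → ℝ → ℝ → ℝ :=
    fun i j s t => cov[fun ω => X s ω i, fun ω => X t ω j; μ] with hγ
  have hcomm : ∀ i j s t, γ i j s t = γ j i t s := fun i j s t => covariance_comm _ _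
  have hl : ∀ i j t, γ i j 0 t = 0 := by
    intro i j t
    have h : (fun ω => X 0 ω i) =ᵐ[μ] fun _ => 0 := by
      filter_upwards [h0] with ω hω
      simp [hω]
    have hint : ∫ ω, X 0 ω i ∂μ = 0 := by simp [integral_congr_ae h]
    refine integral_eq_zero_of_ae ?_
    filter_upwards [h] with ω hω
    simp [hω, hint]
  have hr : ∀ i j t, γ i j t 0 = 0 := fun i j t => by rw [hcomm, hl]
  have hst : ∀ i j h s t, γ i j (s + h) (t + h) - γ i j (s + h) h - γ i j h (t + h) + γ i j h h =
      γ i j s t := by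
    intro i j h s t
    have key := (hincr h).covariance_eq (fun t => (hmeas _).sub (hmeas _))
      (fun t => (hmeas _).sub (hmeas _)) i j s t
    rw [covariance_increments hmem, covariance_increments hmem] at key
    have h1 := hl i j t
    have h2 := hr i j s
    have h3 := hr i j 0
    simp only [hγ] at h1 h2 h3 ⊢
    linarith
  have hscale : ∀ i j c, 0 < c → ∀ s t, γ i j (c * s) (c * t) = c * γ i j s t := by
    intro i j c hc s t
    have key := (hss c hc).covariance_eq (fun t => hmeas _) (fun t => by exact (hmeas t).const_smul (Real.sqrt c)) i j s t
    simp only [Pi.smul_apply, smul_eq_mul] at key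
    rw [covariance_const_mul_left, covariance_const_mul_right, ← mul_assoc,
      Real.mul_self_sqrt hc.le] at key
    exact key
  constructor
  · intro hrev m t ht
    have heven : ∀ i j s t, γ i j (-s) (-t) = γ i j s t := fun i j s t =>
      hrev.covariance_eq (fun t => hmeas _) hmeas i j s t
    have hsymm : ∀ i j s t, γ i j s t = γ i j t s := fun i j =>
      covFun_symm_of_even (hl i j) (hr i j) (hst i j) (hscale i j) (heven i j)
    have horth : ∀ k l : Fin m, k < l → ∀ i j,
        cov[fun ω => (X (t k.succ) ω - X (t k.castSucc) ω) i,
          fun ω => (X (t l.succ) ω - X (t l.castSucc) ω) j; μ] = 0 := by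
      intro k l hkl i j
      rw [covariance_increments hmem]
      refine covFun_increments_eq_zero (hl i j) (hr i j) (hst i j) (hscale i j) (hsymm i j)
        (ht.monotone (Fin.castSucc_lt_succ).le) (ht.monotone ?_)
        (ht.monotone (Fin.castSucc_lt_succ).le)
      exact Fin.succ_le_castSucc_iff.2 hkl
    have hlaw : HasGaussianLaw
        (fun ω (k : Fin m) (i : Fin n) => (X (t k.succ) ω - X (t k.castSucc) ω) i) μ := by
      let L : (Fin (m + 1) → Fin n → ℝ) →L[ℝ] (Fin m → Fin n → ℝ) :=
        ContinuousLinearMap.pi fun k : Fin m =>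
          ContinuousLinearMap.proj (R := ℝ) (φ := fun _ => Fin n → ℝ) k.succ -
            ContinuousLinearMap.proj k.castSucc
      exact (hgauss.hasGaussianLaw hmeas t).map L
    refine hlaw.iIndepFun_of_covariance_eval fun k l hkl i j => ?_
    rcases lt_or_gt_of_ne hkl with h | h
    · exact horth k l h i j
    · rw [covariance_comm]
      exact horth l k h j i
  · intro hind
    have horth : ∀ i j a b c, a < b → b < c →
        γ i j b c - γ i j b b - γ i j a c + γ i j a b = 0 := by
      intro i j a b c hab hbc
      have hmono : StrictMono ![a, b, c] := by
        refine Fin.strictMono_iff_lt_succ.2 fun k => ?_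
        fin_cases k
        · exact hab
        · exact hbc
      have h := (hind 2 ![a, b, c] hmono).indepFun (i := 0) (j := 1) (by decide)
      have h' : IndepFun (fun ω => (X b ω - X a ω) i) (fun ω => (X c ω - X b ω) j) μ :=
        h.comp (measurable_pi_apply i) (measurable_pi_apply j)
      rw [← covariance_increments hmem]
      exact h'.covariance_eq_zero ((hmem _ _).sub (hmem _ _)) ((hmem _ _).sub (hmem _ _))
    have hsymm : ∀ i j s t, γ i j s t = γ i j t s := by
      intro i j
      refine covFun_symm_of_increments (hl i j) (hr i j) (horth i j) fun a b c hab hbc => ?_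
      have h := horth j i a b c hab hbc
      rw [hcomm j i b c, hcomm j i b b, hcomm j i a c, hcomm j i a b] at h
      exact h
    intro m ts
    exact hgauss.map_eq_of_covariance_eq hmeas (fun k => -ts k) ts fun k l i j =>
      covFun_even_of_symm (hl i j) (hr i j) (hst i j) (hsymm i j) (ts k) (ts l)
end
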